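/- arXiv:2109.03984 — 2 statements merged into one kernel-verified Lean document; each statement's English description precedes it below -/
import Mathlib

section
/- In the superalgebra R_n the following relations hold for all admissible indices 1 ≤ i, j ≤ n−1: [[B_i, F_i], E_j] = 2B_i if j = i and [[B_i, F_i], E_j] = 0 otherwise; [[B_i, E_i], E_j] = 2B_{i−1} if j = i−1 and [[B_i, E_i], E_j] = 0 otherwise; [[B_i, E_i], F_j] = 2B_i if j = i and [[B_i, E_i], F_j] = 0 otherwise. -/
/-!
Core: the presentation of the superalgebra `R_n` of Davidson–Kujawa–Muth by
generators and relations (Definition (R1)–(R14)).  Indices are 1-based; the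
generators `E_i, F_i, B_i, C_i` exist for `1 ≤ i ≤ n-1` and `H_i` for
`1 ≤ i ≤ n`.  Out-of-range generator symbols are set to `0`, which yields an
algebra isomorphic to the one presented on exactly the in-range generators.
Since every relation involves only homogeneous generators of known parity, the
supercommutators are written out with explicit signs:
`cm x y = x*y - y*x` (at least one even factor) and
`acm x y = x*y + y*x` (two odd factors).
-/

/-- Generator symbols for the presented superalgebra `R n`. `E i`, `F i`, `H i`
are even; `B11`, `B i`, `C i` are odd. -/
inductive PGen : Type
  | E (i : ℕ) | F (i : ℕ) | H (i : ℕ) | B (i : ℕ) | B11 | C (i : ℕ)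

variable (k : Type) [Field k]

/-- The free algebra on the generator symbols. -/
abbrev FA := FreeAlgebra k PGen

noncomputable def gE (i : ℕ) : FA k := FreeAlgebra.ι k (PGen.E i)
noncomputable def gF (i : ℕ) : FA k := FreeAlgebra.ι k (PGen.F i)
noncomputable def gH (i : ℕ) : FA k := FreeAlgebra.ι k (PGen.H i)
noncomputable def gB (i : ℕ) : FA k := FreeAlgebra.ι k (PGen.B i)
noncomputable def gB11 : FA k := FreeAlgebra.ι k PGen.B11
noncomputable def gC (i : ℕ) : FA k := FreeAlgebra.ι k (PGen.C i)

/-- Commutator (the supercommutator when at least one factor is even). -/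
def cm {A : Type*} [Ring A] (x y : A) : A := x * y - y * x

/-- Anticommutator (the supercommutator of two odd elements). -/
def acm {A : Type*} [Ring A] (x y : A) : A := x * y + y * x

/-- `i` is an admissible index for `E, F, B, C` : `1 ≤ i ≤ n - 1`. -/
def okE (n i : ℕ) : Prop := 1 ≤ i ∧ i + 1 ≤ n

/-- `i` is an admissible index for `H` : `1 ≤ i ≤ n`. -/
def okH (n i : ℕ) : Prop := 1 ≤ i ∧ i ≤ n

/-- Kronecker delta valued in `k`. -/
def del (a b : ℕ) : k := if a = b then 1 else 0

/-- The defining relations (R1)–(R14) of `R_n`, together with relations killing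
the out-of-range generator symbols. -/
inductive PRel (n : ℕ) : FA k → FA k → Prop
  | killE (i : ℕ) (h : ¬ okE n i) : PRel n (gE k i) 0
  | killF (i : ℕ) (h : ¬ okE n i) : PRel n (gF k i) 0
  | killH (i : ℕ) (h : ¬ okH n i) : PRel n (gH k i) 0
  | killB (i : ℕ) (h : ¬ okE n i) : PRel n (gB k i) 0
  | killC (i : ℕ) (h : ¬ okE n i) : PRel n (gC k i) 0
  -- (R1)
  | r1 (i j : ℕ) (hi : okH n i) (hj : okH n j) : PRel n (cm (gH k i) (gH k j)) 0
  -- (R2)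
  | r2e (i j : ℕ) (hi : okH n i) (hj : okE n j) :
      PRel n (cm (gH k i) (gE k j)) ((del k i j - del k i (j+1)) • gE k j)
  | r2f (i j : ℕ) (hi : okH n i) (hj : okE n j) :
      PRel n (cm (gH k i) (gF k j)) ((-(del k i j - del k i (j+1))) • gF k j)
  -- (R3)
  | r3 (i j : ℕ) (hi : okE n i) (hj : okE n j) :
      PRel n (cm (gE k i) (gF k j)) (if i = j then gH k i - gH k (i+1) else 0)
  -- (R4)
  | r4a (i j : ℕ) (hi : okE n i) (hj : okE n j) (h : j ≠ i + 1 ∧ i ≠ j + 1) :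
      PRel n (cm (gE k i) (gE k j)) 0
  | r4b (i j : ℕ) (hi : okE n i) (hj : okE n j) (h : j = i + 1 ∨ i = j + 1) :
      PRel n (cm (gE k i) (cm (gE k i) (gE k j))) 0
  -- (R5)
  | r5a (i j : ℕ) (hi : okE n i) (hj : okE n j) (h : j ≠ i + 1 ∧ i ≠ j + 1) :
      PRel n (cm (gF k i) (gF k j)) 0
  | r5b (i j : ℕ) (hi : okE n i) (hj : okE n j) (h : j = i + 1 ∨ i = j + 1) :
      PRel n (cm (gF k i) (cm (gF k i) (gF k j))) 0
  -- (R6)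
  | r6b (i j : ℕ) (hi : okE n i) (hj : okE n j) : PRel n (acm (gB k i) (gB k j)) 0
  | r6c (i j : ℕ) (hi : okE n i) (hj : okE n j) : PRel n (acm (gC k i) (gC k j)) 0
  -- (R7)
  | r7b (i j : ℕ) (hi : okH n i) (hj : okE n j) :
      PRel n (cm (gH k i) (gB k j)) ((del k i j + del k i (j+1)) • gB k j)
  | r7c (i j : ℕ) (hi : okH n i) (hj : okE n j) :
      PRel n (cm (gH k i) (gC k j)) ((-(del k i j + del k i (j+1))) • gC k j)
  -- (R8)
  | r8i (i : ℕ) (hi : okE n i) :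
      PRel n (acm (gB k i) (gC k i)) (gH k (i+1) - gH k i)
  | r8m (i : ℕ) (hi : okE n i) (hi1 : okE n (i+1)) :
      PRel n (acm (gB k (i+1)) (gC k i)) (cm (gF k i) (gF k (i+1)))
  | r8p (i : ℕ) (hi : okE n i) (hi1 : okE n (i+1)) :
      PRel n (acm (gB k i) (gC k (i+1))) (cm (gE k i) (gE k (i+1)))
  | r8z (i j : ℕ) (hi : okE n i) (hj : okE n j) (h : i ≠ j ∧ i ≠ j + 1 ∧ j ≠ i + 1) :
      PRel n (acm (gB k i) (gC k j)) 0
  -- (R9)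
  | r9f (i j : ℕ) (hi : okE n i) (hj : okE n j) (h : j ≠ i ∧ j ≠ i + 1) :
      PRel n (cm (gB k i) (gF k j)) 0
  | r9e (i j : ℕ) (hi : okE n i) (hj : okE n j) (h : j ≠ i ∧ i ≠ j + 1) :
      PRel n (cm (gB k i) (gE k j)) 0
  | r9c1 (i : ℕ) (hi : okE n i) (hi1 : okE n (i+1)) :
      PRel n (cm (gB k i) (gF k i)) (cm (gB k (i+1)) (gE k (i+1)))
  | r9c2 (i : ℕ) (hi : okE n i) (hi1 : okE n (i+1)) :
      PRel n (cm (gB k i) (gF k (i+1))) (cm (gB k (i+1)) (gE k i))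
  -- (R10)
  | r10f (i j : ℕ) (hi : okE n i) (hj : okE n j) (h : i ≠ j + 1) :
      PRel n (cm (gF k j) (gC k i)) 0
  | r10e (i j : ℕ) (hi : okE n i) (hj : okE n j) (h : j ≠ i + 1) :
      PRel n (cm (gE k j) (gC k i)) 0
  | r10x (i : ℕ) (hi : okE n i) (hi1 : okE n (i+1)) :
      PRel n (cm (gF k i) (gC k (i+1))) (cm (gE k (i+1)) (gC k i))
  -- (R11)
  | r11a (i : ℕ) (hi : okE n i) (hi1 : okE n (i+1)) :
      PRel n (cm (cm (gB k i) (gF k i)) (gF k (i+1))) ((2:k) • gB k (i+1))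
  | r11z (i j : ℕ) (hi : okE n i) (hj : okE n j) (h : j ≠ i + 1) :
      PRel n (cm (cm (gB k i) (gF k i)) (gF k j)) 0
  | r11e (h1 : okE n 1) :
      PRel n (cm (cm (gB k 1) (gF k 1)) (gE k 1)) ((2:k) • gB k 1)
  | r11be (j : ℕ) (h1 : okE n 1) (hj : okE n j) :
      PRel n (cm (cm (gB k 1) (gE k 1)) (gE k j)) 0
  -- (R12)
  | r12a (i : ℕ) (hi : okE n i) (hi1 : okE n (i+1)) :
      PRel n (cm (cm (gC k (i+1)) (gF k i)) (gF k (i+1))) (gC k i)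
  | r12z (i j : ℕ) (hi : okE n i) (hi1 : okE n (i+1)) (hj : okE n j)
      (h : j ≠ i + 1 ∧ i ≠ j + 1) :
      PRel n (cm (cm (gC k (i+1)) (gF k i)) (gF k j)) 0
  -- (R13)
  | r13 (h1 : okE n 1) : PRel n ((2:k) • gB11 k) (cm (gE k 1) (gB k 1))
  -- (R14)
  | r14h (i : ℕ) (hi : okH n i) :
      PRel n (cm (gH k i) (gB11 k)) (((2:k) * del k i 1) • gB11 k)
  | r14sq : PRel n (gB11 k * gB11 k) 0

/-- The presented superalgebra `R_n`. -/
abbrev Rp (n : ℕ) := RingQuot (PRel k n)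

noncomputable def mkR (n : ℕ) : FA k →ₐ[k] Rp k n := RingQuot.mkAlgHom k (PRel k n)

noncomputable def RE (n i : ℕ) : Rp k n := mkR k n (gE k i)
noncomputable def RF (n i : ℕ) : Rp k n := mkR k n (gF k i)
noncomputable def RH (n i : ℕ) : Rp k n := mkR k n (gH k i)
noncomputable def RB (n i : ℕ) : Rp k n := mkR k n (gB k i)
noncomputable def RB11 (n : ℕ) : Rp k n := mkR k n (gB11 k)
noncomputable def RC (n i : ℕ) : Rp k n := mkR k n (gC k i)

section Brackets

variable {k}
variable {A : Type*} [Ring A]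

theorem cm_zero_left (x : A) : cm 0 x = 0 := by simp [cm]

theorem cm_zero_right (x : A) : cm x 0 = 0 := by simp [cm]

theorem cm_swap (x y : A) : cm x y = -cm y x := by simp [cm]

theorem cm_sub_right (x y z : A) : cm x (y - z) = cm x y - cm x z := by
  simp only [cm]; noncomm_ring

theorem cm_neg_right (x y : A) : cm x (-y) = -cm x y := by
  simp only [cm]; noncomm_ring

theorem cm_cm_right_comm (x y z : A) :
    cm (cm x y) z = cm (cm x z) y + cm x (cm y z) := by
  simp only [cm]; noncomm_ring

variable [Algebra k A]

theorem cm_smul_left (c : k) (x y : A) : cm (c • x) y = c • cm x y := by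
  simp [cm, smul_sub]

theorem cm_smul_right (c : k) (x y : A) : cm x (c • y) = c • cm x y := by
  simp [cm, smul_sub]

theorem cm_eq_smul_of_swap {c : k} {x y : A} (h : cm x y = c • y) : cm y x = (-c) • y := by
  rw [cm_swap, h, neg_smul]

theorem cm_sub_right_eq_smul {a b c : k} {x y z : A} (hy : cm x y = a • x)
    (hz : cm x z = b • x) (h : a - b = c) : cm x (y - z) = c • x := by
  rw [cm_sub_right, hy, hz, ← sub_smul, h]

theorem cm_neg_right_eq_smul {c : k} {x y : A} (h : cm x y = c • x) :
    cm x (-y) = (-c) • x := by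
  rw [cm_neg_right, h, neg_smul]

theorem cm_cm_eq_zero_of_weights {a b : k} {x y h : A} (hx : cm x h = a • x)
    (hy : cm y h = b • y) (hab : a + b = 0) : cm (cm x y) h = 0 := by
  rw [cm_cm_right_comm, hx, hy, cm_smul_left, cm_smul_right, ← add_smul, hab, zero_smul]

/-- In a representation of `sl₂`, a lowest weight vector of weight `0` on which `e` acts
nilpotently (of order at most three) is killed by `e`. -/
theorem cm_eq_zero_of_lowest_weight_zero [CharZero k] {y e f h : A}
    (hef : cm e f = h) (hhe : cm e h = (-2 : k) • e)
    (hyf : cm y f = 0) (hyh : cm y h = 0)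
    (hnil : cm (cm (cm y e) e) e = 0) : cm y e = 0 := by
  have y1f : cm (cm y e) f = 0 := by
    rw [cm_cm_right_comm, hyf, hef, hyh, cm_zero_left, add_zero]
  have y1h : cm (cm y e) h = (-2 : k) • cm y e := by
    rw [cm_cm_right_comm, hyh, hhe, cm_smul_right, cm_zero_left, zero_add]
  have y2f : cm (cm (cm y e) e) f = (-2 : k) • cm y e := by
    rw [cm_cm_right_comm, y1f, hef, y1h, cm_zero_left, zero_add]
  have y2h : cm (cm (cm y e) e) h = (-4 : k) • cm (cm y e) e := by
    rw [cm_cm_right_comm, y1h, hhe, cm_smul_right, cm_smul_left, ← add_smul]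
    norm_num
  have y3f : cm (cm (cm (cm y e) e) e) f = (-6 : k) • cm (cm y e) e := by
    rw [cm_cm_right_comm, y2f, hef, y2h, cm_smul_left, ← add_smul]
    norm_num
  rw [hnil, cm_zero_left] at y3f
  have y2 : cm (cm y e) e = 0 :=
    (smul_eq_zero.mp y3f.symm).resolve_left (by norm_num)
  rw [y2, cm_zero_left] at y2f
  exact (smul_eq_zero.mp y2f.symm).resolve_left (by norm_num)

end Brackets

section Relations

variable {k}
variable {n : ℕ}

theorem mkR_rel {x y : FA k} (h : PRel k n x y) : mkR k n x = mkR k n y :=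
  RingQuot.mkAlgHom_rel k h

theorem mkR_cm (x y : FA k) : mkR k n (cm x y) = cm (mkR k n x) (mkR k n y) := by
  simp [cm]

theorem cm_RE_RF_self {i : ℕ} (hi : okE n i) :
    cm (RE k n i) (RF k n i) = RH k n i - RH k n (i + 1) := by
  simpa [mkR_cm, RE, RF, RH, RB] using mkR_rel (PRel.r3 (k := k) i i hi hi)

theorem cm_RE_RF_of_ne {i j : ℕ} (hi : okE n i) (hj : okE n j) (h : i ≠ j) :
    cm (RE k n i) (RF k n j) = 0 := by
  simpa [mkR_cm, h, RE, RF, RH, RB] using mkR_rel (PRel.r3 (k := k) i j hi hj)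

theorem cm_RF_RE_of_ne {i j : ℕ} (hi : okE n i) (hj : okE n j) (h : i ≠ j) :
    cm (RF k n i) (RE k n j) = 0 := by
  rw [cm_swap, cm_RE_RF_of_ne hj hi h.symm, neg_zero]

theorem cm_RE_RH {i j : ℕ} (hi : okH n i) (hj : okE n j) :
    cm (RE k n j) (RH k n i) = (-(del k i j - del k i (j + 1))) • RE k n j := by
  have h : cm (RH k n i) (RE k n j) = (del k i j - del k i (j + 1)) • RE k n j := by
    simpa only [mkR_cm, map_smul, RE, RF, RH, RB] using mkR_rel (PRel.r2e (k := k) i j hi hj)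
  exact cm_eq_smul_of_swap h

theorem cm_RF_RH {i j : ℕ} (hi : okH n i) (hj : okE n j) :
    cm (RF k n j) (RH k n i) = (del k i j - del k i (j + 1)) • RF k n j := by
  have h : cm (RH k n i) (RF k n j) = (-(del k i j - del k i (j + 1))) • RF k n j := by
    simpa only [mkR_cm, map_smul, RE, RF, RH, RB] using mkR_rel (PRel.r2f (k := k) i j hi hj)
  simpa using cm_eq_smul_of_swap h

theorem cm_RB_RH {i j : ℕ} (hi : okH n i) (hj : okE n j) :
    cm (RB k n j) (RH k n i) = (-(del k i j + del k i (j + 1))) • RB k n j := by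
  have h : cm (RH k n i) (RB k n j) = (del k i j + del k i (j + 1)) • RB k n j := by
    simpa only [mkR_cm, map_smul, RE, RF, RH, RB] using mkR_rel (PRel.r7b (k := k) i j hi hj)
  exact cm_eq_smul_of_swap h

theorem cm_RE_coroot {i : ℕ} (hi : okE n i) :
    cm (RE k n i) (RH k n i - RH k n (i + 1)) = (-2 : k) • RE k n i := by
  refine cm_sub_right_eq_smul (cm_RE_RH ⟨hi.1, by have := hi.2; omega⟩ hi)
    (cm_RE_RH ⟨by omega, hi.2⟩ hi) ?_
  simp [del]
  norm_num

theorem cm_RF_coroot {i : ℕ} (hi : okE n i) :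
    cm (RF k n i) (RH k n i - RH k n (i + 1)) = (2 : k) • RF k n i := by
  refine cm_sub_right_eq_smul (cm_RF_RH ⟨hi.1, by have := hi.2; omega⟩ hi)
    (cm_RF_RH ⟨by omega, hi.2⟩ hi) ?_
  simp [del]
  norm_num

theorem cm_RB_coroot {i : ℕ} (hi : okE n i) :
    cm (RB k n i) (RH k n i - RH k n (i + 1)) = 0 := by
  rw [cm_sub_right, cm_RB_RH ⟨hi.1, by have := hi.2; omega⟩ hi,
    cm_RB_RH ⟨by omega, hi.2⟩ hi]
  simp [del]

theorem cm_RB_RF_of_ne {i j : ℕ} (hi : okE n i) (hj : okE n j) (h : j ≠ i ∧ j ≠ i + 1) :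
    cm (RB k n i) (RF k n j) = 0 := by
  simpa [mkR_cm, RE, RF, RH, RB] using mkR_rel (PRel.r9f (k := k) i j hi hj h)

theorem cm_RB_RE_of_ne {i j : ℕ} (hi : okE n i) (hj : okE n j) (h : j ≠ i ∧ i ≠ j + 1) :
    cm (RB k n i) (RE k n j) = 0 := by
  simpa [mkR_cm, RE, RF, RH, RB] using mkR_rel (PRel.r9e (k := k) i j hi hj h)

theorem cm_RB_succ_RE_succ {i : ℕ} (hi : okE n i) (hi1 : okE n (i + 1)) :
    cm (RB k n (i + 1)) (RE k n (i + 1)) = cm (RB k n i) (RF k n i) := by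
  simpa only [mkR_cm, RE, RF, RH, RB] using (mkR_rel (PRel.r9c1 (k := k) i hi hi1)).symm

theorem cm_RB_succ_RE {i : ℕ} (hi : okE n i) (hi1 : okE n (i + 1)) :
    cm (RB k n (i + 1)) (RE k n i) = cm (RB k n i) (RF k n (i + 1)) := by
  simpa only [mkR_cm, RE, RF, RH, RB] using (mkR_rel (PRel.r9c2 (k := k) i hi hi1)).symm

theorem cm_cm_RB_RF_RF_succ {i : ℕ} (hi : okE n i) (hi1 : okE n (i + 1)) :
    cm (cm (RB k n i) (RF k n i)) (RF k n (i + 1)) = (2 : k) • RB k n (i + 1) := by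
  simpa only [mkR_cm, map_smul, RE, RF, RH, RB] using mkR_rel (PRel.r11a (k := k) i hi hi1)

theorem cm_cm_RB_RF_RF_of_ne {i j : ℕ} (hi : okE n i) (hj : okE n j) (h : j ≠ i + 1) :
    cm (cm (RB k n i) (RF k n i)) (RF k n j) = 0 := by
  simpa only [mkR_cm, map_zero, RE, RF, RH, RB] using mkR_rel (PRel.r11z (k := k) i j hi hj h)

theorem cm_cm_RB_one_RF_RE (h1 : okE n 1) :
    cm (cm (RB k n 1) (RF k n 1)) (RE k n 1) = (2 : k) • RB k n 1 := by
  simpa only [mkR_cm, map_smul, RE, RF, RH, RB] using mkR_rel (PRel.r11e (k := k) h1)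

theorem cm_cm_RB_one_RE_RE {j : ℕ} (h1 : okE n 1) (hj : okE n j) :
    cm (cm (RB k n 1) (RE k n 1)) (RE k n j) = 0 := by
  simpa only [mkR_cm, map_zero, RE, RF, RH, RB] using mkR_rel (PRel.r11be (k := k) j h1 hj)

/-- `[[B_i, F_i], E_i] = [[B_i, E_i], F_i]`, as `B_i` has weight zero for the `i`-th coroot. -/
theorem cm_cm_RB_RF_RE_comm {i : ℕ} (hi : okE n i) :
    cm (cm (RB k n i) (RF k n i)) (RE k n i) = cm (cm (RB k n i) (RE k n i)) (RF k n i) := by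
  rw [cm_cm_right_comm (RB k n i) (RE k n i), cm_RE_RF_self hi, cm_RB_coroot hi, add_zero]

theorem cm_cm_RB_RF_RE_self {i : ℕ} (hi : okE n i) :
    cm (cm (RB k n i) (RF k n i)) (RE k n i) = (2 : k) • RB k n i := by
  obtain rfl | ⟨m, rfl, hm⟩ : i = 1 ∨ ∃ m, i = m + 1 ∧ 1 ≤ m := by
    have := hi.1
    by_cases h : i = 1
    · exact .inl h
    · exact .inr ⟨i - 1, by omega, by omega⟩
  · exact cm_cm_RB_one_RF_RE hi
  · have hm' : okE n m := ⟨hm, by have := hi.2; omega⟩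
    rw [cm_cm_RB_RF_RE_comm hi, cm_RB_succ_RE_succ hm' hi, cm_cm_RB_RF_RF_succ hm' hi]

/-- `[[[[B_{m+1}, F_{m+1}], E_m], E_m], E_m] = 0`. -/
theorem cm_cm_RB_succ_RF_succ_RE_pow_three {m : ℕ} (hm : okE n m) (hm1 : okE n (m + 1)) :
    cm (cm (cm (cm (RB k n (m + 1)) (RF k n (m + 1))) (RE k n m)) (RE k n m)) (RE k n m)
      = 0 := by
  have comm (x : Rp k n) : cm (cm x (RF k n (m + 1))) (RE k n m)
      = cm (cm x (RE k n m)) (RF k n (m + 1)) := by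
    rw [cm_cm_right_comm, cm_RF_RE_of_ne hm1 hm (by omega), cm_zero_right, add_zero]
  have hE : cm (cm (cm (RB k n m) (RE k n m)) (RF k n (m + 1))) (RE k n m) = 0 := by
    obtain rfl | ⟨l, rfl, hl⟩ : m = 1 ∨ ∃ l, m = l + 1 ∧ 1 ≤ l := by
      have := hm.1
      by_cases h : m = 1
      · exact .inl h
      · exact .inr ⟨m - 1, by omega, by omega⟩
    · rw [comm, cm_cm_RB_one_RE_RE hm hm, cm_zero_left]
    · have hl' : okE n l := ⟨hl, by have := hm.2; omega⟩
      rw [cm_RB_succ_RE_succ hl' hm, cm_cm_RB_RF_RF_of_ne hl' hm1 (by omega), cm_zero_left]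
  rw [comm, cm_RB_succ_RE hm hm1, comm, comm, comm, hE, cm_zero_left]

theorem cm_cm_RB_succ_RF_succ_RE [CharZero k] {m : ℕ} (hm : okE n m) (hm1 : okE n (m + 1)) :
    cm (cm (RB k n (m + 1)) (RF k n (m + 1))) (RE k n m) = 0 := by
  refine cm_eq_zero_of_lowest_weight_zero (k := k) (cm_RE_RF_self hm) (cm_RE_coroot hm)
    (cm_cm_RB_RF_RF_of_ne hm1 hm (by omega)) ?_
    (cm_cm_RB_succ_RF_succ_RE_pow_three hm hm1)
  have hH : okH n m := ⟨hm.1, by have := hm.2; omega⟩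
  have hH1 : okH n (m + 1) := ⟨by omega, hm.2⟩
  have hB : cm (RB k n (m + 1)) (RH k n m - RH k n (m + 1)) = (1 : k) • RB k n (m + 1) := by
    refine cm_sub_right_eq_smul (cm_RB_RH hH hm1) (cm_RB_RH hH1 hm1) ?_
    simp [del, show m ≠ m + 1 + 1 by omega]
  have hF : cm (RF k n (m + 1)) (RH k n m - RH k n (m + 1)) = (-1 : k) • RF k n (m + 1) := by
    refine cm_sub_right_eq_smul (cm_RF_RH hH hm1) (cm_RF_RH hH1 hm1) ?_
    simp [del, show m ≠ m + 1 + 1 by omega]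
  exact cm_cm_eq_zero_of_weights hB hF (by norm_num)

theorem cm_cm_RB_RF_RE_of_ne [CharZero k] {i j : ℕ} (hi : okE n i) (hj : okE n j)
    (h : j ≠ i) : cm (cm (RB k n i) (RF k n i)) (RE k n j) = 0 := by
  by_cases hij : i = j + 1
  · subst hij
    exact cm_cm_RB_succ_RF_succ_RE hj hi
  · rw [cm_cm_right_comm, cm_RB_RE_of_ne hi hj ⟨h, hij⟩, cm_RF_RE_of_ne hi hj h.symm,
      cm_zero_left, cm_zero_right, add_zero]

theorem cm_cm_RB_one_RE_RF_two [CharZero k] (h1 : okE n 1) (h2 : okE n 2) :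
    cm (cm (RB k n 1) (RE k n 1)) (RF k n 2) = 0 := by
  have comm (x : Rp k n) : cm (cm x (RE k n 1)) (RF k n 2)
      = cm (cm x (RF k n 2)) (RE k n 1) := by
    rw [cm_cm_right_comm, cm_RE_RF_of_ne h1 h2 (by omega), cm_zero_right, add_zero]
  have hnil : cm (cm (cm (RB k n 1) (RE k n 1)) (RF k n 2)) (RF k n 2) = 0 := by
    rw [comm, comm, ← cm_RB_succ_RE h1 h2, comm, cm_cm_RB_succ_RF_succ_RE h1 h2, cm_zero_left]
  refine cm_eq_zero_of_lowest_weight_zero (k := k) (f := RE k n 2)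
    (h := -(RH k n 2 - RH k n 3)) ?_ ?_ (cm_cm_RB_one_RE_RE h1 h2) ?_ ?_
  · rw [cm_swap, cm_RE_RF_self h2]
  · exact cm_neg_right_eq_smul (cm_RF_coroot h2)
  · have hH2 : okH n 2 := ⟨by omega, h1.2⟩
    have hH3 : okH n 3 := ⟨by omega, h2.2⟩
    have hB : cm (RB k n 1) (RH k n 2 - RH k n 3) = (-1 : k) • RB k n 1 := by
      refine cm_sub_right_eq_smul (cm_RB_RH hH2 h1) (cm_RB_RH hH3 h1) ?_
      simp [del]
    have hE : cm (RE k n 1) (RH k n 2 - RH k n 3) = (1 : k) • RE k n 1 := by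
      refine cm_sub_right_eq_smul (cm_RE_RH hH2 h1) (cm_RE_RH hH3 h1) ?_
      simp [del]
    rw [cm_neg_right, cm_cm_eq_zero_of_weights hB hE (by norm_num), neg_zero]
  · rw [hnil, cm_zero_left]

end Relations

/-- Lemma on additional relations in `R_n`:
For all admissible `1 ≤ i, j ≤ n-1`:
`[[B_i,F_i],E_j] = 2B_i` if `j = i` and `0` otherwise;
`[[B_i,E_i],E_j] = 2B_{i-1}` if `j = i-1` and `0` otherwise;
`[[B_i,E_i],F_j] = 2B_i` if `j = i` and `0` otherwise.
(The elements `[B_i,F_i]` and `[B_i,E_i]` are odd, so all the iterated brackets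
are the supercommutators written out with explicit signs.) -/
theorem statement0 (k : Type) [Field k] [CharZero k] [IsAlgClosed k]
    (n i j : ℕ) (hi : 1 ≤ i ∧ i + 1 ≤ n) (hj : 1 ≤ j ∧ j + 1 ≤ n) :
    (cm (cm (RB k n i) (RF k n i)) (RE k n j)
        = if j = i then (2:k) • RB k n i else 0) ∧
    (cm (cm (RB k n i) (RE k n i)) (RE k n j)
        = if j + 1 = i then (2:k) • RB k n j else 0) ∧
    (cm (cm (RB k n i) (RE k n i)) (RF k n j)
        = if j = i then (2:k) • RB k n i else 0) := by
  have hiE : okE n i := hi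
  have hjE : okE n j := hj
  refine ⟨?_, ?_⟩
  · split_ifs with h
    · rw [h, cm_cm_RB_RF_RE_self hiE]
    · exact cm_cm_RB_RF_RE_of_ne hiE hjE h
  obtain rfl | ⟨m, rfl, hm⟩ : i = 1 ∨ ∃ m, i = m + 1 ∧ 1 ≤ m := by
    by_cases h : i = 1
    · exact .inl h
    · exact .inr ⟨i - 1, by omega, by omega⟩
  · refine ⟨?_, ?_⟩
    · rw [if_neg (by omega), cm_cm_RB_one_RE_RE hiE hjE]
    · split_ifs with h
      · rw [h, ← cm_cm_RB_RF_RE_comm hiE, cm_cm_RB_RF_RE_self hiE]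
      · by_cases h2 : j = 2
        · subst h2
          exact cm_cm_RB_one_RE_RF_two hiE hjE
        · rw [cm_cm_right_comm, cm_RB_RF_of_ne hiE hjE ⟨h, h2⟩,
            cm_RE_RF_of_ne hiE hjE (Ne.symm h), cm_zero_left, cm_zero_right, add_zero]
  · have hmE : okE n m := ⟨hm, by omega⟩
    rw [cm_RB_succ_RE_succ hmE hiE]
    refine ⟨?_, ?_⟩
    · split_ifs with h
      · obtain rfl : j = m := by omega
        exact cm_cm_RB_RF_RE_self hjE
      · exact cm_cm_RB_RF_RE_of_ne hmE hjE (by omega)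
    · split_ifs with h
      · rw [h, cm_cm_RB_RF_RF_succ hmE hiE]
      · exact cm_cm_RB_RF_RF_of_ne hmE hjE h
end

section
/- For all m, n ≥ 1, the linear map Φ_{m,n}: S(U') → S(U), defined on the monomial basis by ∏_{(k,ℓ)∈I_{m,n}} (z'_{k,ℓ})^{d_{k,ℓ}} (z'_{−k,ℓ})^{ε_{k,ℓ}} ↦ (−1)^{ξ(ε)} ∏_{(k,ℓ)∈I_{m,n}} z_{k,ℓ}^{d_{k,ℓ}} z_{k,−ℓ}^{1−ε_{k,ℓ}} with d_{k,ℓ} ∈ Z_{≥0}, ε_{k,ℓ} ∈ {0,1} and ξ(ε) = Σ_{(a,b)∈I_{m,n}} (n(a−1)+b+mn−1)ε_{a,b}, is an isomorphism of U(p̃(m)) ⊗ U(p(n))-modules, homogeneous of parity mn (mod 2). -/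
/-!
Core: a concrete model of the supersymmetric algebra
`S(U) = S(Y_F ⊗ V_L)` (with `F` purely even "tensor slots" and `V_L = k^{L|L}`)
via its monomial basis.  A basis monomial is a pair `(d, ε)` where
`d : Fin F × Fin L → ℕ` records the exponents of the even variables
`z_{i,ℓ}` (`ℓ > 0`) and `ε : Fin F × Fin L → Bool` records the occurrences of
the odd variables `z_{i,-ℓ}`, the odd variables being ordered
lexicographically by position `(i, ℓ)`.  The multiplication and derivation
operators `z_{i,±ℓ}` and `∂_{i,±ℓ}` are defined on this basis with the signs
dictated by supercommutativity.  The same space also models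
`S(U') = S(W_F ⊗ Y_L)` (with `W_F = k^{F|F}`), via the variables
`z'_{±i,ℓ}`, the odd variable `z'_{-i,ℓ}` occupying the position `(i,ℓ)`.
-/

/-- The index set `I_{L|L}` (`inl` = positive/even, `inr` = negative/odd). -/
abbrev Ix (L : ℕ) := Fin L ⊕ Fin L

/-- Negation `r ↦ -r` on `I_{L|L}`. -/
def nIx {L : ℕ} : Ix L → Ix L := Sum.elim Sum.inr Sum.inl

/-- `(-1)^{|r|}` for `r ∈ I_{L|L}`. -/
def sgn (k : Type) [Field k] {L : ℕ} : Ix L → k :=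
  Sum.elim (fun _ => (1:k)) (fun _ => (-1:k))

/-- Basis monomials: even exponents and odd occurrence flags. -/
abbrev MonB (F L : ℕ) := (Fin F × Fin L → ℕ) × (Fin F × Fin L → Bool)

variable (k : Type) [Field k]

/-- The model of `S(Y_F ⊗ V_L)` (equivalently of `S(W_F ⊗ Y_L)`). -/
abbrev SM (F L : ℕ) := MonB F L →₀ k

noncomputable def bvec (F L : ℕ) (b : MonB F L) : SM k F L := Finsupp.single b 1

/-- The vacuum monomial `1`. -/
noncomputable def vac (F L : ℕ) : SM k F L := bvec k F L (fun _ => 0, fun _ => false)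

/-- Extend a map defined on basis monomials to a linear endomorphism. -/
noncomputable def opOf (F L : ℕ) (f : MonB F L → SM k F L) :
    Module.End k (SM k F L) := Finsupp.linearCombination k f

/-- Position code of `(i,ℓ)` (lexicographic). -/
def posIdx {F L : ℕ} (p : Fin F × Fin L) : ℕ := p.1.val * L + p.2.val

/-- The number of odd variables occurring strictly before position `p`. -/
noncomputable def oddBefore {F L : ℕ} (ε : Fin F × Fin L → Bool)
    (p : Fin F × Fin L) : ℕ :=
  (Finset.univ.filter fun q : Fin F × Fin L => posIdx q < posIdx p ∧ ε q = true).card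

/-- Multiplication by the even variable at position `(i,ℓ)`. -/
noncomputable def zE (F L : ℕ) (i : Fin F) (j : Fin L) : Module.End k (SM k F L) :=
  opOf k F L fun b =>
    bvec k F L (Function.update b.1 (i, j) (b.1 (i, j) + 1), b.2)

/-- Derivation with respect to the even variable at position `(i,ℓ)`. -/
noncomputable def dE (F L : ℕ) (i : Fin F) (j : Fin L) : Module.End k (SM k F L) :=
  opOf k F L fun b =>
    (b.1 (i, j) : k) • bvec k F L (Function.update b.1 (i, j) (b.1 (i, j) - 1), b.2)

/-- (Left) multiplication by the odd variable at position `(i,ℓ)`. -/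
noncomputable def zO (F L : ℕ) (i : Fin F) (j : Fin L) : Module.End k (SM k F L) :=
  opOf k F L fun b =>
    if b.2 (i, j) then 0
    else ((-1:k) ^ oddBefore b.2 (i, j)) •
      bvec k F L (b.1, Function.update b.2 (i, j) true)

/-- (Left) derivation with respect to the odd variable at position `(i,ℓ)`. -/
noncomputable def dO (F L : ℕ) (i : Fin F) (j : Fin L) : Module.End k (SM k F L) :=
  opOf k F L fun b =>
    if b.2 (i, j) then
      ((-1:k) ^ oddBefore b.2 (i, j)) •
        bvec k F L (b.1, Function.update b.2 (i, j) false)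
    else 0

/-- Multiplication by the variable `z_{i,r}`, `r ∈ I_{L|L}`. -/
noncomputable def zop (F L : ℕ) (i : Fin F) (r : Ix L) : Module.End k (SM k F L) :=
  Sum.elim (zE k F L i) (zO k F L i) r

/-- The derivation `∂_{i,r}`, `r ∈ I_{L|L}`. -/
noncomputable def dop (F L : ℕ) (i : Fin F) (r : Ix L) : Module.End k (SM k F L) :=
  Sum.elim (dE k F L i) (dO k F L i) r

/-- `𝙴_{a,b} = Σ_{p=1}^F z_{p,a} ∂_{p,b}` for `a, b ∈ I_{L|L}`: the operator by
which the matrix unit `E_{a,b} ∈ gl(L|L)` acts naturally on `S(Y_F ⊗ V_L)`. -/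
noncomputable def EEop (F L : ℕ) (a b : Ix L) : Module.End k (SM k F L) :=
  ∑ p : Fin F, zop k F L p a * dop k F L p b

/-- `𝙰_{i,j} = 𝙴_{i,j} - 𝙴_{-j,-i}`: the natural action of `a_{i,j} ∈ p(L)`. -/
noncomputable def opA (F L : ℕ) (i j : Fin L) : Module.End k (SM k F L) :=
  EEop k F L (Sum.inl i) (Sum.inl j) - EEop k F L (Sum.inr j) (Sum.inr i)

/-- `𝙱_{i,j} = 𝙴_{i,-j} + 𝙴_{j,-i}` (`i < j`), `𝙱_{i,i} = 𝙴_{i,-i}`: the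
natural action of `b_{i,j} ∈ p(L)`. -/
noncomputable def opB (F L : ℕ) (i j : Fin L) : Module.End k (SM k F L) :=
  if i = j then EEop k F L (Sum.inl i) (Sum.inr i)
  else EEop k F L (Sum.inl i) (Sum.inr j) + EEop k F L (Sum.inl j) (Sum.inr i)

/-- `𝙲_{i,j} = 𝙴_{-i,j} - 𝙴_{-j,i}` (`i < j`): the natural action of
`c_{i,j} ∈ p(L)`. -/
noncomputable def opC (F L : ℕ) (i j : Fin L) : Module.End k (SM k F L) :=
  EEop k F L (Sum.inr i) (Sum.inl j) - EEop k F L (Sum.inr j) (Sum.inl i)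

/-- `Ã_{i,j} = Σ_{r ∈ I_{L|L}} z_{i,r} ∂_{j,r} - L·δ_{i,j}` (`1 ≤ i,j ≤ F`). -/
noncomputable def tA (F L : ℕ) (i j : Fin F) : Module.End k (SM k F L) :=
  (∑ r : Ix L, zop k F L i r * dop k F L j r) - (if i = j then (L : k) • 1 else 0)

/-- `B̃_{i,j} = Σ_{r ∈ I_{L|L}} ∂_{i,r} ∂_{j,-r}` (`i ≠ j`), and
`B̃_{i,i} = Σ_{r=1}^{L} ∂_{i,r} ∂_{i,-r}`. -/
noncomputable def tB (F L : ℕ) (i j : Fin F) : Module.End k (SM k F L) :=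
  if i = j then ∑ q : Fin L, dE k F L i q * dO k F L i q
  else ∑ r : Ix L, dop k F L i r * dop k F L j (nIx r)

/-- `C̃_{i,j} = Σ_{r ∈ I_{L|L}} (-1)^{|r|} z_{i,r} z_{j,-r}` (`i < j`). -/
noncomputable def tC (F L : ℕ) (i j : Fin F) : Module.End k (SM k F L) :=
  ∑ r : Ix L, sgn k r • (zop k F L i r * zop k F L j (nIx r))

/-- Multiplication by the variable `z'_{a,ℓ}`, `a ∈ I_{F|F}`, of
`S(W_F ⊗ Y_L)` in the same model. -/
noncomputable def zop2 (F L : ℕ) (a : Ix F) (j : Fin L) : Module.End k (SM k F L) :=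
  Sum.elim (fun i => zE k F L i j) (fun i => zO k F L i j) a

/-- The derivation `∂'_{a,ℓ}`, `a ∈ I_{F|F}`. -/
noncomputable def dop2 (F L : ℕ) (a : Ix F) (j : Fin L) : Module.End k (SM k F L) :=
  Sum.elim (fun i => dE k F L i j) (fun i => dO k F L i j) a

/-- `𝙴'_{a,b} = Σ_{p=1}^L z'_{a,p} ∂'_{b,p}` for `a, b ∈ I_{F|F}`: the natural
action of the matrix unit `E_{a,b} ∈ gl(F|F)` on `S(W_F ⊗ Y_L)`. -/
noncomputable def EE2op (F L : ℕ) (a b : Ix F) : Module.End k (SM k F L) :=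
  ∑ p : Fin L, zop2 k F L a p * dop2 k F L b p

/-- `Ã'_{i,j} = 𝙴'_{i,j} - 𝙴'_{-j,-i}`: the natural action of
`ã_{i,j} ∈ p̃(F)`. -/
noncomputable def opA2 (F L : ℕ) (i j : Fin F) : Module.End k (SM k F L) :=
  EE2op k F L (Sum.inl i) (Sum.inl j) - EE2op k F L (Sum.inr j) (Sum.inr i)

/-- `B̃'_{i,j} = 𝙴'_{-i,j} + 𝙴'_{-j,i}` (`i < j`), `B̃'_{i,i} = 𝙴'_{-i,i}`:
the natural action of `b̃_{i,j} ∈ p̃(F)`. -/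
noncomputable def opB2 (F L : ℕ) (i j : Fin F) : Module.End k (SM k F L) :=
  if i = j then EE2op k F L (Sum.inr i) (Sum.inl i)
  else EE2op k F L (Sum.inr i) (Sum.inl j) + EE2op k F L (Sum.inr j) (Sum.inl i)

/-- `C̃'_{i,j} = 𝙴'_{i,-j} - 𝙴'_{j,-i}` (`i < j`): the natural action of
`c̃_{i,j} ∈ p̃(F)`. -/
noncomputable def opC2 (F L : ℕ) (i j : Fin F) : Module.End k (SM k F L) :=
  EE2op k F L (Sum.inl i) (Sum.inr j) - EE2op k F L (Sum.inl j) (Sum.inr i)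

/-- `θ'(a_{i,j}) = Σ_{r ∈ I_{F|F}} z'_{r,i} ∂'_{r,j} - F·δ_{i,j}`. -/
noncomputable def pA2 (F L : ℕ) (i j : Fin L) : Module.End k (SM k F L) :=
  (∑ r : Ix F, zop2 k F L r i * dop2 k F L r j) - (if i = j then (F : k) • 1 else 0)

/-- `θ'(b_{i,j}) = Σ_{r ∈ I_{F|F}} z'_{r,i} z'_{-r,j}` (`i ≠ j`), and
`θ'(b_{i,i}) = Σ_{r=1}^{F} z'_{r,i} z'_{-r,i}`. -/
noncomputable def pB2 (F L : ℕ) (i j : Fin L) : Module.End k (SM k F L) :=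
  if i = j then ∑ s : Fin F, zop2 k F L (Sum.inl s) i * zop2 k F L (Sum.inr s) i
  else ∑ r : Ix F, zop2 k F L r i * zop2 k F L (nIx r) j

/-- `θ'(c_{i,j}) = Σ_{r ∈ I_{F|F}} (-1)^{|r|} ∂'_{-r,i} ∂'_{r,j}` (`i < j`). -/
noncomputable def pC2 (F L : ℕ) (i j : Fin L) : Module.End k (SM k F L) :=
  ∑ r : Ix F, sgn k r • (dop2 k F L (nIx r) i * dop2 k F L r j)

/-- A monomial is even if it contains an even number of odd variables. -/
def evenMon {F L : ℕ} (b : MonB F L) : Prop :=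
  (Finset.univ.filter fun p : Fin F × Fin L => b.2 p = true).card % 2 = 0

noncomputable instance {F L : ℕ} (b : MonB F L) : Decidable (evenMon b) := by
  unfold evenMon; infer_instance

/-- The even part of the model of `S(U)`. -/
noncomputable def SMev (F L : ℕ) : Submodule k (SM k F L) where
  carrier := {s | ∀ b, ¬ evenMon b → s b = 0}
  add_mem' := by
    intro a b ha hb b' hb'
    simp [Finsupp.add_apply, ha b' hb', hb b' hb']
  zero_mem' := by intro b _; simp
  smul_mem' := by
    intro c a ha b hb
    simp [Finsupp.smul_apply, ha b hb]

/-- The odd part of the model of `S(U)`. -/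
noncomputable def SMod (F L : ℕ) : Submodule k (SM k F L) where
  carrier := {s | ∀ b, evenMon b → s b = 0}
  add_mem' := by
    intro a b ha hb b' hb'
    simp [Finsupp.add_apply, ha b' hb', hb b' hb']
  zero_mem' := by intro b _; simp
  smul_mem' := by
    intro c a ha b hb
    simp [Finsupp.smul_apply, ha b hb]

/-- Projection onto the even part. -/
noncomputable def Pe (F L : ℕ) : Module.End k (SM k F L) :=
  opOf k F L fun b => if evenMon b then bvec k F L b else 0

/-- Projection onto the odd part. -/
noncomputable def Po (F L : ℕ) : Module.End k (SM k F L) :=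
  opOf k F L fun b => if evenMon b then 0 else bvec k F L b

/-- The even component of an operator. -/
noncomputable def evPart (F L : ℕ) (f : Module.End k (SM k F L)) :
    Module.End k (SM k F L) :=
  Pe k F L * f * Pe k F L + Po k F L * f * Po k F L

/-- The odd component of an operator. -/
noncomputable def odPart (F L : ℕ) (f : Module.End k (SM k F L)) :
    Module.End k (SM k F L) :=
  Pe k F L * f * Po k F L + Po k F L * f * Pe k F L

/-- An operator is even if its odd component vanishes. -/
def IsEvenOp (F L : ℕ) (f : Module.End k (SM k F L)) : Prop := odPart k F L f = 0
/-- An operator is odd if its even component vanishes. -/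
def IsOddOp (F L : ℕ) (f : Module.End k (SM k F L)) : Prop := evPart k F L f = 0

/-- The supercommutator `[g, f]`, extended bilinearly from homogeneous
components: `[g,f] = g∘f - f∘g + 2·(odd part of f)∘(odd part of g)`. -/
noncomputable def sbrk (F L : ℕ) (g f : Module.End k (SM k F L)) :
    Module.End k (SM k F L) :=
  g * f - f * g + (2:k) • (odPart k F L f * odPart k F L g)

/-- The supercommutator `[g, f]` for an *even* `g`. -/
noncomputable def evComm (F L : ℕ) (g f : Module.End k (SM k F L)) :
    Module.End k (SM k F L) := g * f - f * g

/-- The supercommutator `[g, f]` for an *odd* (homogeneous) `g`: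
`[g,f] = g∘f - (even part of f)∘g + (odd part of f)∘g`. -/
noncomputable def odComm (F L : ℕ) (g f : Module.End k (SM k F L)) :
    Module.End k (SM k F L) :=
  g * f - evPart k F L f * g + odPart k F L f * g

/-- The Weyl–Clifford superalgebra `WC(U)`: the subalgebra of `End(S(U))`
generated by the multiplication operators and the superderivations. -/
noncomputable def WCsub (F L : ℕ) : Subalgebra k (Module.End k (SM k F L)) :=
  Algebra.adjoin k
    ({f | ∃ p r, f = zop k F L p r} ∪ {f | ∃ p r, f = dop k F L p r})

/-- The sign exponent
`ξ(ε) = Σ_{(a,b) ∈ I_{m,n}} (n(a-1) + b + mn - 1) ε_{a,b}`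
(with 1-based indices `(a,b)`; in 0-based indices the coefficient is
`n·a + b + mn`). -/
def xiExp {m n : ℕ} (eps : Fin m × Fin n → Bool) : ℕ :=
  ∑ p : Fin m × Fin n, (n * p.1.val + p.2.val + m * n) * (if eps p then 1 else 0)

/-- The intertwiner `Φ_{m,n} : S(U') → S(U)`, given on the monomial basis by
`∏ (z'_{k,ℓ})^{d_{k,ℓ}} (z'_{-k,ℓ})^{ε_{k,ℓ}} ↦
 (-1)^{ξ(ε)} ∏ z_{k,ℓ}^{d_{k,ℓ}} z_{k,-ℓ}^{1-ε_{k,ℓ}}`.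
Both `S(U')` and `S(U)` are modelled on `SM k m n`; in the source model the
odd variable `z'_{-k,ℓ}` occupies position `(k,ℓ)`, in the target model the
odd variable `z_{k,-ℓ}` occupies position `(k,ℓ)`. -/
noncomputable def PhiMap (m n : ℕ) : Module.End k (SM k m n) :=
  Finsupp.linearCombination k fun b : MonB m n =>
    ((-1:k) ^ xiExp b.2) • bvec k m n (b.1, fun p => ! b.2 p)

section Intertwiner

variable {F L : ℕ}

theorem opOf_bvec (f : MonB F L → SM k F L) (b : MonB F L) :
    opOf k F L f (bvec k F L b) = f b := by
  simp [opOf, bvec]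

theorem PhiMap_bvec (b : MonB F L) :
    PhiMap k F L (bvec k F L b) =
      ((-1 : k) ^ xiExp b.2) • bvec k F L (b.1, fun p => ! b.2 p) := by
  simp [PhiMap, bvec]

variable {k} in
theorem end_ext_bvec {f g : Module.End k (SM k F L)}
    (h : ∀ b, f (bvec k F L b) = g (bvec k F L b)) : f = g :=
  Finsupp.lhom_ext' fun b => LinearMap.ext_ring (h b)

/-! Ring identities for subtraction in `Module.End k (SM k F L)`, restated so that they are
syntactically applicable to the subtraction of linear maps found by instance search there. -/

variable {k} in
theorem end_mul_sub (f g h : Module.End k (SM k F L)) : f * (g - h) = f * g - f * h :=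
  mul_sub f g h

variable {k} in
theorem end_sub_mul (f g h : Module.End k (SM k F L)) : (f - g) * h = f * h - g * h :=
  sub_mul f g h

variable {k} in
theorem end_eq_sub_of_add_eq {f g h : Module.End k (SM k F L)} (e : f + h = g) : f = g - h := by
  subst e
  refine LinearMap.ext fun x => Finsupp.ext fun b => ?_
  simp

variable {k} in
theorem end_sub_sub_eq (f g h : Module.End k (SM k F L)) : f - (g - h) = f + h - g := by
  refine LinearMap.ext fun x => Finsupp.ext fun b => ?_
  simp
  ring

variable {k} in
theorem end_add_sub_sub_eq (f g h : Module.End k (SM k F L)) : f + (g - h) - g = f - h := by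
  refine LinearMap.ext fun x => Finsupp.ext fun b => ?_
  simp
  ring

variable {k} in
theorem end_add_neg_one_smul (f g : Module.End k (SM k F L)) : f + (-1 : k) • g = f - g := by
  refine LinearMap.ext fun x => Finsupp.ext fun b => ?_
  simp
  ring

variable {k} in
theorem end_smul_sub (c : k) (f g : Module.End k (SM k F L)) : c • (f - g) = c • f - c • g :=
  smul_sub c f g

theorem posIdx_injective : Function.Injective (posIdx : Fin F × Fin L → ℕ) := by
  rintro ⟨a, b⟩ ⟨c, d⟩ h
  have h' := congrArg (fun x : Fin F × Fin L => (x.1, x.2))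
    (finProdFinEquiv.injective (a₁ := (a, b)) (a₂ := (c, d))
      (by ext; simp only [posIdx] at h; simp; linarith))
  exact h'

theorem card_posIdx_lt (p : Fin F × Fin L) :
    (Finset.univ.filter fun q : Fin F × Fin L => posIdx q < posIdx p).card = posIdx p := by
  have hp (q : Fin F × Fin L) : posIdx q = (finProdFinEquiv q : ℕ) := by
    simp [posIdx]; ring
  have h : (Finset.univ.filter fun q : Fin F × Fin L => posIdx q < posIdx p).map
      finProdFinEquiv.toEmbedding = Finset.Iio (finProdFinEquiv p) := by
    ext x
    simp only [Finset.mem_map_equiv, Finset.mem_filter, Finset.mem_univ, true_and,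
      Finset.mem_Iio, hp, Equiv.apply_symm_apply, Fin.lt_def]
  rw [← Finset.card_map finProdFinEquiv.toEmbedding, h, Fin.card_Iio, hp]

theorem oddBefore_not_add (ε : Fin F × Fin L → Bool) (p : Fin F × Fin L) :
    oddBefore (fun q => ! ε q) p + oddBefore ε p = posIdx p := by
  rw [← card_posIdx_lt p, add_comm]
  unfold oddBefore
  rw [← Finset.card_filter_add_card_filter_not (fun q => ε q = true)
    (s := Finset.univ.filter fun q : Fin F × Fin L => posIdx q < posIdx p),
    Finset.filter_filter, Finset.filter_filter]
  simp

theorem oddBefore_update_of_not_lt (ε : Fin F × Fin L → Bool) {p q : Fin F × Fin L} (v : Bool)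
    (h : ¬ posIdx p < posIdx q) :
    oddBefore (Function.update ε p v) q = oddBefore ε q := by
  unfold oddBefore
  congr 1
  refine Finset.filter_congr fun x _ => and_congr_right fun hx => ?_
  rw [Function.update_of_ne (by rintro rfl; exact h hx)]

theorem oddBefore_update_true (ε : Fin F × Fin L → Bool) {p q : Fin F × Fin L}
    (h : posIdx p < posIdx q) (hε : ε p = false) :
    oddBefore (Function.update ε p true) q = oddBefore ε q + 1 := by
  unfold oddBefore
  rw [← Finset.card_insert_of_notMem (a := p) (by simp [hε])]
  congr 1
  ext x
  by_cases hx : x = p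
  · subst hx; simp [h]
  · simp [hx]

theorem oddBefore_update_false (ε : Fin F × Fin L → Bool) {p q : Fin F × Fin L}
    (h : posIdx p < posIdx q) (hε : ε p = true) :
    oddBefore (Function.update ε p false) q + 1 = oddBefore ε q := by
  rw [← oddBefore_update_true _ h (by simp)]
  simp [← hε]

theorem xiExp_update_true (ε : Fin F × Fin L → Bool) {p : Fin F × Fin L} (hε : ε p = false) :
    xiExp (Function.update ε p true) = xiExp ε + (posIdx p + F * L) := by
  unfold xiExp
  rw [← Finset.add_sum_erase _ _ (Finset.mem_univ p),
    ← Finset.add_sum_erase (a := p) (f := fun p : Fin F × Fin L =>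
      (L * p.1.val + p.2.val + F * L) * (if ε p then 1 else 0)) _ (Finset.mem_univ p)]
  rw [Finset.sum_congr rfl fun x hx => by
    rw [Function.update_of_ne (Finset.ne_of_mem_erase hx)]]
  simp [hε, posIdx]
  ring

theorem neg_one_pow_eq {a b : ℕ} (h : a % 2 = b % 2) : (-1 : k) ^ a = (-1) ^ b := by
  rw [neg_one_pow_eq_pow_mod_two, h, ← neg_one_pow_eq_pow_mod_two]

theorem not_update (ε : Fin F × Fin L → Bool) (p : Fin F × Fin L) (v : Bool) :
    (fun q => ! Function.update ε p v q) = Function.update (fun q => ! ε q) p (!v) := by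
  ext q
  by_cases h : q = p
  · subst h; simp
  · simp [h]

theorem PhiMap_zE (i : Fin F) (j : Fin L) :
    PhiMap k F L * zE k F L i j = zE k F L i j * PhiMap k F L :=
  end_ext_bvec fun b => by simp [zE, opOf_bvec, PhiMap_bvec]

theorem PhiMap_dE (i : Fin F) (j : Fin L) :
    PhiMap k F L * dE k F L i j = dE k F L i j * PhiMap k F L :=
  end_ext_bvec fun b => by simp [dE, opOf_bvec, PhiMap_bvec, smul_smul, mul_comm]

theorem PhiMap_zO (i : Fin F) (j : Fin L) :
    PhiMap k F L * zO k F L i j = ((-1 : k) ^ (F * L)) • (dO k F L i j * PhiMap k F L) := by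
  refine end_ext_bvec fun b => ?_
  by_cases h : b.2 (i, j) = true
  · simp [zO, dO, opOf_bvec, PhiMap_bvec, h]
  · have h' : b.2 (i, j) = false := by simpa using h
    simp only [zO, dO, Module.End.mul_apply, LinearMap.smul_apply, opOf_bvec, PhiMap_bvec, h',
      map_smul, smul_smul, not_update, Bool.not_true, Bool.not_false, if_true, if_false,
      Bool.false_eq_true, ← pow_add]
    congr 1
    apply neg_one_pow_eq
    have h1 := oddBefore_not_add b.2 (i, j)
    have h2 := xiExp_update_true b.2 h'
    omega

theorem PhiMap_dO (i : Fin F) (j : Fin L) :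
    PhiMap k F L * dO k F L i j = ((-1 : k) ^ (F * L)) • (zO k F L i j * PhiMap k F L) := by
  refine end_ext_bvec fun b => ?_
  by_cases h : b.2 (i, j) = true
  · simp only [zO, dO, Module.End.mul_apply, LinearMap.smul_apply, opOf_bvec, PhiMap_bvec, h,
      map_smul, smul_smul, not_update, Bool.not_true, Bool.not_false, if_true, if_false,
      Bool.false_eq_true, ← pow_add]
    congr 1
    apply neg_one_pow_eq
    have h1 := oddBefore_not_add b.2 (i, j)
    have h2 := xiExp_update_true (Function.update b.2 (i, j) false) (p := (i, j)) (by simp)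
    have hu : Function.update b.2 (i, j) true = b.2 := by
      rw [← h, Function.update_eq_self]
    rw [Function.update_idem, hu] at h2
    omega
  · simp [zO, dO, opOf_bvec, PhiMap_bvec, h]

theorem zE_zO_comm (i i' : Fin F) (j j' : Fin L) :
    zE k F L i j * zO k F L i' j' = zO k F L i' j' * zE k F L i j :=
  end_ext_bvec fun b => by
    by_cases h : b.2 (i', j') = true <;> simp [zE, zO, opOf_bvec, h]

theorem dE_zO_comm (i i' : Fin F) (j j' : Fin L) :
    dE k F L i j * zO k F L i' j' = zO k F L i' j' * dE k F L i j :=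
  end_ext_bvec fun b => by
    by_cases h : b.2 (i', j') = true <;> simp [dE, zO, opOf_bvec, h, smul_smul, mul_comm]

theorem dE_dO_comm (i i' : Fin F) (j j' : Fin L) :
    dE k F L i j * dO k F L i' j' = dO k F L i' j' * dE k F L i j :=
  end_ext_bvec fun b => by
    by_cases h : b.2 (i', j') = true <;> simp [dE, dO, opOf_bvec, h, smul_smul, mul_comm]

/-- The canonical anticommutation relations between the odd variables and derivations. -/
theorem dO_zO_add_zO_dO (i i' : Fin F) (j j' : Fin L) :
    dO k F L i j * zO k F L i' j' + zO k F L i' j' * dO k F L i j =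
      if (i, j) = (i', j') then 1 else 0 := by
  refine end_ext_bvec fun b => ?_
  have hself (ε : Fin F × Fin L → Bool) (q) (v) :
      oddBefore (Function.update ε q v) q = oddBefore ε q :=
    oddBefore_update_of_not_lt ε v (lt_irrefl _)
  by_cases hpq : (i, j) = (i', j')
  · obtain ⟨rfl, rfl⟩ := Prod.mk.inj hpq
    have hsq (a : ℕ) : (-1 : k) ^ a * (-1) ^ a = 1 := by rw [← mul_pow]; simp
    by_cases h : b.2 (i, j) = true
    · have hu : Function.update b.2 (i, j) true = b.2 := by
        rw [← h, Function.update_eq_self]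
      simp [zO, dO, opOf_bvec, h, hself, smul_smul, hsq, hu]
    · have h' : b.2 (i, j) = false := by simpa using h
      have hu : Function.update b.2 (i, j) false = b.2 := by
        rw [← h', Function.update_eq_self]
      simp [zO, dO, opOf_bvec, h', hself, smul_smul, hsq, hu]
  · have hqp : ¬ (i', j') = (i, j) := fun h => hpq h.symm
    rw [if_neg hpq]
    generalize hp : (i, j) = p at *
    generalize hq : (i', j') = q at *
    by_cases h : b.2 p = true <;> by_cases h' : b.2 q = true
    · simp [zO, dO, opOf_bvec, hp, hq, h, h', Function.update_of_ne hqp]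
    · have h'' : b.2 q = false := by simpa using h'
      simp only [zO, dO, hp, hq, LinearMap.add_apply, Module.End.mul_apply, opOf_bvec, h, h'',
        Function.update_of_ne hqp, Function.update_of_ne hpq, map_smul, smul_smul, if_true,
        if_false, Bool.false_eq_true, ← pow_add, LinearMap.zero_apply,
        Function.update_comm hpq]
      rw [← add_smul]
      convert zero_smul k _
      rcases lt_or_gt_of_ne (fun e => hpq (posIdx_injective e)) with hlt | hlt
      · rw [oddBefore_update_of_not_lt _ _ hlt.not_gt, ← oddBefore_update_false _ hlt h]
        ring
      · rw [oddBefore_update_of_not_lt _ _ hlt.not_gt, oddBefore_update_true _ hlt h'']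
        ring
    · simp [zO, dO, opOf_bvec, hp, hq, h, h']
    · simp [zO, dO, opOf_bvec, hp, hq, h, h', Function.update_of_ne hpq]

theorem neg_one_pow_mul_self (a : ℕ) : (-1 : k) ^ a * (-1) ^ a = 1 := by
  rw [← mul_pow]; simp

theorem PhiMap_zE_dE (i i' : Fin F) (j j' : Fin L) :
    PhiMap k F L * (zE k F L i j * dE k F L i' j') =
      zE k F L i j * dE k F L i' j' * PhiMap k F L := by
  rw [← mul_assoc, PhiMap_zE, mul_assoc, PhiMap_dE, ← mul_assoc]

theorem PhiMap_zO_dO (i i' : Fin F) (j j' : Fin L) :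
    PhiMap k F L * (zO k F L i j * dO k F L i' j') =
      dO k F L i j * zO k F L i' j' * PhiMap k F L := by
  rw [← mul_assoc, PhiMap_zO, smul_mul_assoc, mul_assoc, PhiMap_dO, mul_smul_comm, smul_smul,
    neg_one_pow_mul_self, one_smul, ← mul_assoc]

theorem PhiMap_zE_zO (i i' : Fin F) (j j' : Fin L) :
    PhiMap k F L * (zE k F L i j * zO k F L i' j') =
      ((-1 : k) ^ (F * L)) • (zE k F L i j * dO k F L i' j' * PhiMap k F L) := by
  rw [← mul_assoc, PhiMap_zE, mul_assoc, PhiMap_zO, mul_smul_comm, ← mul_assoc]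

theorem PhiMap_zE_dO (i i' : Fin F) (j j' : Fin L) :
    PhiMap k F L * (zE k F L i j * dO k F L i' j') =
      ((-1 : k) ^ (F * L)) • (zE k F L i j * zO k F L i' j' * PhiMap k F L) := by
  rw [← mul_assoc, PhiMap_zE, mul_assoc, PhiMap_dO, mul_smul_comm, ← mul_assoc]

theorem PhiMap_zO_dE (i i' : Fin F) (j j' : Fin L) :
    PhiMap k F L * (zO k F L i j * dE k F L i' j') =
      ((-1 : k) ^ (F * L)) • (dE k F L i' j' * dO k F L i j * PhiMap k F L) := by
  rw [← dE_zO_comm, ← mul_assoc, PhiMap_dE, mul_assoc, PhiMap_zO, mul_smul_comm, ← mul_assoc]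

theorem PhiMap_dE_dO (i i' : Fin F) (j j' : Fin L) :
    PhiMap k F L * (dE k F L i j * dO k F L i' j') =
      ((-1 : k) ^ (F * L)) • (zO k F L i' j' * dE k F L i j * PhiMap k F L) := by
  rw [← mul_assoc, PhiMap_dE, mul_assoc, PhiMap_dO, mul_smul_comm, ← mul_assoc, dE_zO_comm]

theorem PhiMap_opA2 (i j : Fin F) :
    PhiMap k F L * opA2 k F L i j = tA k F L i j * PhiMap k F L := by
  have hc : ∑ p : Fin L, dO k F L j p * zO k F L i p =
      (if i = j then (L : k) • 1 else 0) - ∑ p : Fin L, zO k F L i p * dO k F L j p := by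
    apply end_eq_sub_of_add_eq
    rw [← Finset.sum_add_distrib]
    simp only [dO_zO_add_zO_dO, Prod.mk.injEq, and_true, eq_comm (a := j)]
    split_ifs <;> simp [Nat.cast_smul_eq_nsmul]
  simp only [opA2, tA, EE2op, zop, dop, zop2, dop2, Sum.elim_inl, Sum.elim_inr,
    Fintype.sum_sum_type, end_mul_sub, Finset.mul_sum, PhiMap_zE_dE, PhiMap_zO_dO]
  rw [← Finset.sum_mul, ← Finset.sum_mul, ← end_sub_mul, hc, end_sub_sub_eq]

theorem PhiMap_opB2 (i j : Fin F) :
    PhiMap k F L * opB2 k F L i j = ((-1 : k) ^ (F * L)) • (tB k F L i j * PhiMap k F L) := by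
  unfold opB2 tB
  split_ifs with h
  · subst h
    simp only [EE2op, zop2, dop2, Sum.elim_inl, Sum.elim_inr, Finset.mul_sum, Finset.sum_mul,
      Finset.smul_sum, PhiMap_zO_dE]
  · simp only [EE2op, zop2, dop2, dop, nIx, Sum.elim_inl, Sum.elim_inr, Fintype.sum_sum_type,
      mul_add, add_mul, Finset.mul_sum, Finset.sum_mul, Finset.smul_sum, smul_add,
      PhiMap_zO_dE, ← dE_dO_comm]
    exact add_comm _ _

theorem PhiMap_opC2 (i j : Fin F) :
    PhiMap k F L * opC2 k F L i j = ((-1 : k) ^ (F * L)) • (tC k F L i j * PhiMap k F L) := by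
  simp only [opC2, tC, EE2op, zop2, dop2, zop, nIx, sgn, Sum.elim_inl, Sum.elim_inr,
    Fintype.sum_sum_type, one_smul, ← Finset.smul_sum, end_add_neg_one_smul, ← zE_zO_comm,
    end_mul_sub, end_sub_mul, end_smul_sub, Finset.mul_sum, Finset.sum_mul, PhiMap_zE_dO]

theorem PhiMap_pA2 (i j : Fin L) :
    PhiMap k F L * pA2 k F L i j = opA k F L i j * PhiMap k F L := by
  have hc : ∑ s : Fin F, dO k F L s i * zO k F L s j =
      (if i = j then (F : k) • 1 else 0) - ∑ s : Fin F, zO k F L s j * dO k F L s i := by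
    apply end_eq_sub_of_add_eq
    rw [← Finset.sum_add_distrib]
    simp only [dO_zO_add_zO_dO, Prod.mk.injEq, true_and]
    split_ifs <;> simp [Nat.cast_smul_eq_nsmul]
  have hδ : PhiMap k F L * (if i = j then (F : k) • 1 else 0) =
      (if i = j then (F : k) • 1 else 0) * PhiMap k F L := by
    split_ifs <;> simp
  simp only [opA, pA2, EEop, zop, dop, zop2, dop2, Sum.elim_inl, Sum.elim_inr,
    Fintype.sum_sum_type, end_mul_sub, mul_add, Finset.mul_sum, PhiMap_zE_dE, PhiMap_zO_dO, hδ]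
  rw [← Finset.sum_mul, ← Finset.sum_mul, ← add_mul, ← end_sub_mul, hc, end_add_sub_sub_eq]

theorem PhiMap_pB2 (i j : Fin L) :
    PhiMap k F L * pB2 k F L i j = ((-1 : k) ^ (F * L)) • (opB k F L i j * PhiMap k F L) := by
  unfold pB2 opB
  split_ifs with h
  · subst h
    simp only [EEop, zop2, zop, dop, Sum.elim_inl, Sum.elim_inr, Finset.mul_sum, Finset.sum_mul,
      Finset.smul_sum, PhiMap_zE_zO]
  · simp only [EEop, zop2, zop, dop, nIx, Sum.elim_inl, Sum.elim_inr, Fintype.sum_sum_type,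
      mul_add, add_mul, Finset.mul_sum, Finset.sum_mul, Finset.smul_sum, smul_add,
      PhiMap_zE_zO, ← zE_zO_comm]

theorem PhiMap_pC2 (i j : Fin L) :
    PhiMap k F L * pC2 k F L i j = ((-1 : k) ^ (F * L)) • (opC k F L i j * PhiMap k F L) := by
  simp only [pC2, opC, EEop, dop2, dop, zop, nIx, sgn, Sum.elim_inl, Sum.elim_inr,
    Fintype.sum_sum_type, one_smul, ← Finset.smul_sum, end_add_neg_one_smul, ← dE_dO_comm,
    end_mul_sub, end_sub_mul, end_smul_sub, Finset.mul_sum, Finset.sum_mul, PhiMap_dE_dO]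

theorem PhiMap_apply (s : SM k F L) (b : MonB F L) :
    PhiMap k F L s b = (-1 : k) ^ xiExp (fun p => ! b.2 p) * s (b.1, fun p => ! b.2 p) := by
  induction s using Finsupp.induction_linear with
  | zero => simp
  | add f g hf hg => simp [hf, hg, mul_add]
  | single a c =>
    have hiff : (a.1, fun p => ! a.2 p) = b ↔ a = (b.1, fun p => ! b.2 p) := by
      constructor <;> rintro rfl <;> simp
    by_cases h : a = (b.1, fun p => ! b.2 p)
    · subst h
      simp [PhiMap, bvec, mul_comm]
    · have h' := mt hiff.1 h
      simp [PhiMap, bvec, Finsupp.single_eq_of_ne' h, Finsupp.single_eq_of_ne' h']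

theorem PhiMap_bijective : Function.Bijective (PhiMap k F L) := by
  constructor
  · rw [injective_iff_map_eq_zero]
    intro s hs
    ext b
    have h := DFunLike.congr_fun hs (b.1, fun p => ! b.2 p)
    simpa [PhiMap_apply] using h
  · intro s
    induction s using Finsupp.induction_linear with
    | zero => exact ⟨0, map_zero _⟩
    | add f g hf hg =>
      obtain ⟨⟨x, rfl⟩, ⟨y, rfl⟩⟩ := hf, hg
      exact ⟨x + y, map_add _ _ _⟩
    | single b c =>
      refine ⟨(c * (-1 : k) ^ xiExp fun p => ! b.2 p) •
        bvec k F L (b.1, fun p => ! b.2 p), ?_⟩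
      rw [map_smul, PhiMap_bvec, smul_smul, mul_assoc, neg_one_pow_mul_self]
      simp [bvec]

theorem card_not_add (b : MonB F L) :
    (Finset.univ.filter fun p : Fin F × Fin L => (! b.2 p) = true).card +
      (Finset.univ.filter fun p : Fin F × Fin L => b.2 p = true).card = F * L := by
  have h := Finset.card_filter_add_card_filter_not (fun p => b.2 p = true)
    (s := (Finset.univ : Finset (Fin F × Fin L)))
  simp only [Finset.card_univ, Fintype.card_prod, Fintype.card_fin] at h
  rw [← h, add_comm]
  simp

theorem evenMon_not_iff (b : MonB F L) :
    evenMon ((b.1, fun p => ! b.2 p) : MonB F L) ↔ (evenMon b ↔ Even (F * L)) := by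
  have h := card_not_add b
  simp only [evenMon, Nat.even_iff]
  omega

end Intertwiner

/-- for all `m, n ≥ 1` the map `Φ_{m,n} : S(U') → S(U)` is
an isomorphism of `U(p̃(m)) ⊗ U(p(n))`-modules which is homogeneous of parity
`mn (mod 2)`.  Here `U(p̃(m))` acts on `S(U')` through the natural embedding
`p̃(m) → WC(U')` (operators `Ã'_{i,j}, B̃'_{i,j}, C̃'_{i,j}`) and on `S(U)`
through `θ̃` (operators `Ã_{i,j}, B̃_{i,j}, C̃_{i,j}`), while `U(p(n))` acts
on `S(U')` through `θ'` (operators `𝙰'_{i,j}, 𝙱'_{i,j}, 𝙲'_{i,j}`) and on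
`S(U)` through the natural embedding `p(n) → WC(U)` (operators
`𝙰_{i,j}, 𝙱_{i,j}, 𝙲_{i,j}`).  Being a module isomorphism of parity `mn`
means: `Φ` is bijective, maps the even/odd parts to the parts of parity
shifted by `mn`, and satisfies `Φ(x·v) = (-1)^{|x|·mn} x·Φ(v)` for all
homogeneous `x` in either Lie superalgebra. -/
theorem statement18 (k : Type) [Field k] [CharZero k] [IsAlgClosed k]
    (m n : ℕ) (hm : 1 ≤ m) (hn : 1 ≤ n) :
    -- Φ is bijective
    Function.Bijective (PhiMap k m n) ∧
    -- Φ is homogeneous of parity mn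
    (∀ s ∈ SMev k m n,
      PhiMap k m n s ∈ (if Even (m * n) then SMev k m n else SMod k m n)) ∧
    (∀ s ∈ SMod k m n,
      PhiMap k m n s ∈ (if Even (m * n) then SMod k m n else SMev k m n)) ∧
    -- Φ intertwines the two U(p̃(m))-actions (with the parity sign)
    (∀ i j : Fin m,
      PhiMap k m n * opA2 k m n i j = tA k m n i j * PhiMap k m n) ∧
    (∀ i j : Fin m, i ≤ j →
      PhiMap k m n * opB2 k m n i j
        = ((-1:k) ^ (m * n)) • (tB k m n i j * PhiMap k m n)) ∧
    (∀ i j : Fin m, i < j →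
      PhiMap k m n * opC2 k m n i j
        = ((-1:k) ^ (m * n)) • (tC k m n i j * PhiMap k m n)) ∧
    -- Φ intertwines the two U(p(n))-actions (with the parity sign)
    (∀ i j : Fin n,
      PhiMap k m n * pA2 k m n i j = opA k m n i j * PhiMap k m n) ∧
    (∀ i j : Fin n, i ≤ j →
      PhiMap k m n * pB2 k m n i j
        = ((-1:k) ^ (m * n)) • (opB k m n i j * PhiMap k m n)) ∧
    (∀ i j : Fin n, i < j →
      PhiMap k m n * pC2 k m n i j
        = ((-1:k) ^ (m * n)) • (opC k m n i j * PhiMap k m n)) := by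
  refine ⟨PhiMap_bijective k, ?_, ?_, PhiMap_opA2 k, fun i j _ => PhiMap_opB2 k i j,
    fun i j _ => PhiMap_opC2 k i j, PhiMap_pA2 k, fun i j _ => PhiMap_pB2 k i j,
    fun i j _ => PhiMap_pC2 k i j⟩
  · intro s hs
    split_ifs with h <;> intro b hb <;>
      rw [PhiMap_apply, hs _ (by rw [evenMon_not_iff]; tauto), mul_zero]
  · intro s hs
    split_ifs with h <;> intro b hb <;>
      rw [PhiMap_apply, hs _ (by rw [evenMon_not_iff]; tauto), mul_zero]
end
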